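/- For every nonempty homogeneous Σ¹₁ set A = ∏ₙAₙ with every Aₙ finite, there exists a homogeneous Σ¹₁ set B = ∏ₙBₙ, where each Bₙ is either all of ℕ or nonempty and finite, such that A <_M B. -/

import Mathlib

open Set

/-- Baire space. -/
abbrev Baire : Type := ℕ → ℕ

/-- The length-`n` initial segment of `x : Baire`, as a finite sequence. -/
def pre (x : Baire) (n : ℕ) : List ℕ := (List.range n).map x

/-- A Turing functional, presented by a total computable monotone map on
finite sequences. -/
structure TuringFunctional where
  φ : List ℕ → List ℕ
  computable : Computable φ
  mono : ∀ σ τ : List ℕ, σ <+: τ → φ σ <+: φ τ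

/-- `Φ` is defined on `x` with value `y`: every coordinate of `y` is eventually
output by `Φ` on initial segments of `x`. -/
def TuringFunctional.Eval (Φ : TuringFunctional) (x y : Baire) : Prop :=
  ∀ n, ∃ m, (Φ.φ (pre x m))[n]? = some (y n)

/-- Medvedev reducibility: some Turing functional is defined on every element
of `Q` and maps `Q` into `P`. -/
def MedvedevLE (P Q : Set Baire) : Prop :=
  ∃ Φ : TuringFunctional, ∀ x ∈ Q, ∃ y ∈ P, Φ.Eval x y

/-- Strict Medvedev reducibility. -/
def MedvedevLT (P Q : Set Baire) : Prop := MedvedevLE P Q ∧ ¬ MedvedevLE Q P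

/-- The homogeneous set `∏ₙ Aₙ`. -/
def homProd (A : ℕ → Set ℕ) : Set Baire := {x | ∀ n, x n ∈ A n}

/-- A family `(Aₙ)` of subsets of `ℕ` is uniformly `Σ¹₁`. -/
def UniformlySigma11 (A : ℕ → Set ℕ) : Prop :=
  ∃ R : ℕ × ℕ → List ℕ → Bool, Computable₂ R ∧
    ∀ n m : ℕ, m ∈ A n ↔ ∃ y : Baire, ∀ k, R (n, m) (pre y k) = true

/-- A subset of Baire space is (lightface) `Σ¹₁`. -/
def Sigma11Set (S : Set Baire) : Prop :=
  ∃ R : List ℕ → List ℕ → Bool, Computable₂ R ∧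
    ∀ x, x ∈ S ↔ ∃ y : Baire, ∀ m, R (pre x m) (pre y m) = true

/-- A set of finite sequences is (lightface) `Σ¹₁`. -/
def Sigma11List (T : Set (List ℕ)) : Prop :=
  ∃ R : List ℕ → List ℕ → Bool, Computable₂ R ∧
    ∀ σ, σ ∈ T ↔ ∃ y : Baire, ∀ m, R σ (pre y m) = true

/-- A tree on `ℕ`: a set of finite sequences closed under prefixes. -/
def IsTree (T : Set (List ℕ)) : Prop := ∀ σ ∈ T, ∀ τ : List ℕ, τ <+: σ → τ ∈ T

/-- The set `[T]` of infinite paths through `T`. -/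
def paths (T : Set (List ℕ)) : Set Baire := {x | ∀ n, pre x n ∈ T}

/-- A subset of `ℕ × ℕ` is (lightface) `Σ¹₁`. -/
def Sigma11Pairs (A : Set (ℕ × ℕ)) : Prop :=
  ∃ R : ℕ × ℕ → List ℕ → Bool, Computable₂ R ∧
    ∀ p : ℕ × ℕ, p ∈ A ↔ ∃ y : Baire, ∀ k, R p (pre y k) = true

/-- A function `f : ℕ → ℕ` is `Δ¹₁`: its graph is both `Σ¹₁` and `Π¹₁`. -/
def Delta11Fun (f : ℕ → ℕ) : Prop :=
  Sigma11Pairs {p : ℕ × ℕ | f p.1 = p.2} ∧ Sigma11Pairs {p : ℕ × ℕ | f p.1 ≠ p.2}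

section Prefixes

@[simp] lemma length_pre (x : Baire) (n : ℕ) : (pre x n).length = n := by simp [pre]

@[simp] lemma pre_zero (x : Baire) : pre x 0 = [] := rfl

lemma getD_pre (x : Baire) {i n : ℕ} (h : i < n) : (pre x n).getD i 0 = x i := by
  simp [pre, h]

lemma take_pre (x : Baire) {m n : ℕ} (h : m ≤ n) : (pre x n).take m = pre x m := by
  rw [pre, pre, ← List.map_take, List.take_range, min_eq_left h]

lemma pre_prefix (x : Baire) {m n : ℕ} (h : m ≤ n) : pre x m <+: pre x n :=
  take_pre x h ▸ List.take_prefix _ _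

/-- A chain of nodes of unbounded length in a prefix-closed set determines a branch. -/
lemma exists_branch_of_chain {U : List ℕ → Prop} (hU : ∀ σ τ, σ <+: τ → U τ → U σ)
    (g : ℕ → List ℕ) (hg : ∀ k, U (g k)) (hpre : ∀ k, g k <+: g (k + 1))
    (hlen : ∀ k, k ≤ (g k).length) : ∃ z : Baire, ∀ k, U (pre z k) := by
  have hmono : ∀ {m n}, m ≤ n → g m <+: g n := fun {m n} h =>
    Nat.le_induction (List.prefix_refl _) (fun n _ ih => ih.trans (hpre n)) n h
  refine ⟨fun n => (g (n + 1)).getD n 0, fun k => hU _ (g k) ?_ (hg k)⟩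
  rw [List.prefix_iff_getElem?]
  intro i hi
  simp only [length_pre] at hi
  have h1 := (List.prefix_iff_getElem?.1 (hmono (Nat.succ_le_of_lt hi))) i
    (Nat.lt_of_lt_of_le (Nat.lt_succ_self i) (hlen (i + 1)))
  have h2 : i < (g (i + 1)).length := Nat.lt_of_lt_of_le (Nat.lt_succ_self i) (hlen (i + 1))
  rw [h1]
  simp [pre, h2]

end Prefixes

section Sigma

variable {α : Type*} [Primcodable α]

/-- A predicate on a `Primcodable` type is (lightface) `Σ¹₁`. -/
def IsSigma11 (P : α → Prop) : Prop :=
  ∃ R : α → List ℕ → Bool, Computable₂ R ∧ ∀ a, P a ↔ ∃ y : Baire, ∀ k, R a (pre y k) = true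

/-- The conjunction of the values of a computable predicate below a computable bound. -/
lemma Computable.forall_le {q : α → ℕ → Bool} (hq : Computable₂ q) {b : α → ℕ}
    (hb : Computable b) :
      ∃ r : α → Bool, Computable r ∧ ∀ a, r a = true ↔ ∀ k ≤ b a, q a k = true := by
  let g : α → ℕ → Bool := fun a n => Nat.rec true (fun k r => r && q a k) n
  have key : ∀ a n, g a n = true ↔ ∀ k < n, q a k = true := by
    intro a n
    induction n with
    | zero => simp [g]
    | succ n ih =>
      rw [Nat.forall_lt_succ_right, ← ih]
      exact Bool.and_eq_true_iff
  refine ⟨fun a => g a (b a + 1), ?_, fun a => ?_⟩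
  · refine Computable.nat_rec (h := fun a p => p.2 && q a p.1) (Computable.succ.comp hb)
      (Computable.const true) ?_
    exact Primrec.and.to_comp.comp (Computable.snd.comp Computable.snd)
      (hq.comp Computable.fst (Computable.fst.comp Computable.snd))
  · simp only [key, Nat.lt_succ_iff]

/-- A `Σ¹₁` predicate is witnessed by branches through a computable family of trees. -/
lemma IsSigma11.exists_tree {P : α → Prop} (hP : IsSigma11 P) :
    ∃ U : α → List ℕ → Bool, Computable₂ U ∧ (∀ a, U a [] = true) ∧
      (∀ a σ τ, σ <+: τ → U a τ = true → U a σ = true) ∧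
      ∀ a, P a ↔ ∃ y : Baire, ∀ k, U a (pre y k) = true := by
  obtain ⟨R, hR, hPR⟩ := hP
  have hq : Computable₂ fun (p : α × List ℕ) (k : ℕ) => R p.1 (p.2.take k) :=
    hR.comp (Computable.fst.comp Computable.fst)
      (Primrec.list_take.to_comp.comp Computable.snd (Computable.snd.comp Computable.fst))
  obtain ⟨r, hr, hrq⟩ := Computable.forall_le hq
    (b := fun p => p.2.length) (Computable.list_length.comp Computable.snd)
  have hnil : Computable fun p : α × List ℕ => decide (p.2 = []) :=
    ((Primrec.eq.comp (Primrec.snd : Primrec (Prod.snd : α × List ℕ → _))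
      (Primrec.const [])).decide).to_comp
  have hU : ∀ a σ, (decide (σ = []) || r (a, σ)) = true ↔
      (σ = [] ∨ ∀ k ≤ σ.length, R a (σ.take k) = true) := by
    intro a σ
    rw [Bool.or_eq_true, hrq, decide_eq_true_eq]
  refine ⟨fun a σ => decide (σ = []) || r (a, σ), Primrec.or.to_comp.comp hnil hr,
    fun a => by simp, fun a σ τ hστ => ?_, fun a => ?_⟩
  · simp only [hU]
    rintro (rfl | h)
    · exact Or.inl (List.prefix_nil.1 hστ)
    · refine Or.inr fun k hk => ?_
      have := h k (hk.trans hστ.length_le)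
      rw [List.prefix_iff_eq_take.1 hστ, List.take_take, min_eq_left hk]
      exact this
  · simp only [hU, hPR]
    refine exists_congr fun y => ⟨fun h k => Or.inr fun j hj => ?_, fun h k => ?_⟩
    · rw [length_pre] at hj
      rw [take_pre y hj]
      exact h j
    · have h1 := (h (k + 1)).resolve_left (by simp [← List.length_eq_zero_iff]) k (by simp)
      rwa [take_pre y (Nat.le_succ k)] at h1

/-- `Σ¹₁` predicates are closed under `∃ x : Baire, ∀ k`. -/
lemma IsSigma11.exists_forall {Q : α × List ℕ → Prop} (hQ : IsSigma11 Q) :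
    IsSigma11 fun a => ∃ x : Baire, ∀ k, Q (a, pre x k) := by
  obtain ⟨R, hR, hQR⟩ := hQ
  let fstPart : List ℕ → List ℕ := fun l =>
    (List.range l.length.unpair.1).map fun i => (l.getD i 0).unpair.1
  let sndPart : List ℕ → List ℕ := fun l =>
    (List.range l.length.unpair.2).map fun j => (l.getD (Nat.pair l.length.unpair.1 j) 0).unpair.2
  have hlen : Primrec fun l : List ℕ => l.length.unpair := Primrec.unpair.comp Primrec.list_length
  have hfst : Primrec fstPart :=
    Primrec.list_map (Primrec.list_range.comp (Primrec.fst.comp hlen))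
      (Primrec.fst.comp (Primrec.unpair.comp (Primrec.list_getD 0))).to₂
  have hsnd : Primrec sndPart := by
    refine Primrec.list_map (Primrec.list_range.comp (Primrec.snd.comp hlen)) ?_
    exact (Primrec.snd.comp (Primrec.unpair.comp ((Primrec.list_getD 0).comp Primrec.fst
      (Primrec₂.natPair.comp (Primrec.fst.comp (hlen.comp Primrec.fst)) Primrec.snd))))
  have hR' : Computable₂ fun (a : α) (l : List ℕ) => R (a, fstPart l) (sndPart l) :=
    hR.comp (Computable.pair Computable.fst (hfst.to_comp.comp Computable.snd))
      (hsnd.to_comp.comp Computable.snd)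
  have e1 : ∀ (z : Baire) (t k : ℕ),
      fstPart (pre z (Nat.pair t k)) = pre (fun i => (z i).unpair.1) t := by
    intro z t k
    simp only [fstPart, length_pre, Nat.unpair_pair]
    refine List.map_congr_left fun i hi => ?_
    rw [getD_pre z ((List.mem_range.1 hi).trans_le (Nat.left_le_pair t k))]
  have e2 : ∀ (z : Baire) (t k : ℕ),
      sndPart (pre z (Nat.pair t k)) = pre (fun j => (z (Nat.pair t j)).unpair.2) k := by
    intro z t k
    simp only [sndPart, length_pre, Nat.unpair_pair]
    refine List.map_congr_left fun j hj => ?_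
    rw [getD_pre z (Nat.pair_lt_pair_right t (List.mem_range.1 hj))]
  refine ⟨_, hR', fun a => ?_⟩
  simp only [hQR]
  constructor
  · rintro ⟨x, hx⟩
    choose y hy using hx
    refine ⟨fun n => Nat.pair (x n) (y n.unpair.1 n.unpair.2), fun N => ?_⟩
    rw [← Nat.pair_unpair N, e1, e2]
    simpa using hy N.unpair.1 N.unpair.2
  · rintro ⟨z, hz⟩
    refine ⟨fun i => (z i).unpair.1, fun t => ⟨fun j => (z (Nat.pair t j)).unpair.2, fun k => ?_⟩⟩
    rw [← e1 z t k, ← e2 z t k]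
    exact hz _

/-- A computable condition on all pairs of values of a function defines a `Σ¹₁` predicate. -/
lemma IsSigma11.exists_forall_pair {q : α → (ℕ × ℕ) × (ℕ × ℕ) → Bool} (hq : Computable₂ q) :
    IsSigma11 fun a => ∃ y : Baire, ∀ i j, q a ((i, y i), (j, y j)) = true := by
  let ix : List ℕ → ℕ × ℕ := fun l => (l.length - 1).unpair
  have hix : Primrec ix := Primrec.unpair.comp
    (Primrec.nat_sub.comp Primrec.list_length (Primrec.const 1))
  have hget {f : List ℕ → ℕ} (hf : Primrec f) : Primrec fun l : List ℕ => (f l, l.getD (f l) 0) :=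
    hf.pair ((Primrec.list_getD 0).comp Primrec.id hf)
  have harg := (hget (Primrec.fst.comp hix)).pair (hget (Primrec.snd.comp hix))
  have hnil : Computable fun p : α × List ℕ => decide (p.2 = []) :=
    ((Primrec.eq.comp (Primrec.snd : Primrec (Prod.snd : α × List ℕ → _))
      (Primrec.const [])).decide).to_comp
  refine ⟨_, (Primrec.or.to_comp.comp hnil
    (hq.comp Computable.fst (harg.to_comp.comp Computable.snd))).to₂, fun a => ?_⟩
  refine exists_congr fun y => ?_
  have key : ∀ i j, ix (pre y (Nat.pair i j + 1)) = (i, j) := by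
    intro i j
    simp [ix]
  constructor
  · intro h k
    rcases k with _ | N
    · simp
    · rw [← Nat.pair_unpair N, Bool.or_eq_true]
      right
      simp only [key]
      rw [getD_pre y (Nat.lt_succ_of_le (Nat.left_le_pair _ _)),
        getD_pre y (Nat.lt_succ_of_le (Nat.right_le_pair _ _))]
      exact h _ _
  · intro h i j
    have := h (Nat.pair i j + 1)
    simp only [key, Bool.or_eq_true] at this
    rw [getD_pre y (Nat.lt_succ_of_le (Nat.left_le_pair _ _)),
      getD_pre y (Nat.lt_succ_of_le (Nat.right_le_pair _ _))] at this
    exact this.resolve_left (by simp [← List.length_eq_zero_iff])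

end Sigma

section Simulation

/-- `f` maps the tree `U` into the tree `V`, preserving the parent relation and raising the level
of every node by `s`. -/
def IsSimulation (s : ℕ) (U V : List ℕ → Prop) (f : List ℕ → List ℕ) : Prop :=
  ∀ σ, U σ → V (f σ) ∧ (f σ).length = σ.length + s ∧ (σ ≠ [] → (f σ).dropLast = f σ.dropLast)

/-- `τ` is a child of `σ` in the tree `U`. -/
def IsChild (U : List ℕ → Prop) (τ σ : List ℕ) : Prop := U τ ∧ ∃ a, τ = σ ++ [a]

variable {U V W : List ℕ → Prop} {s t : ℕ} {f g : List ℕ → List ℕ}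

lemma IsSimulation.comp (hg : IsSimulation t V W g) (hf : IsSimulation s U V f) :
    IsSimulation (s + t) U W (g ∘ f) := by
  intro σ hσ
  obtain ⟨h1, h2, h3⟩ := hf σ hσ
  obtain ⟨h4, h5, h6⟩ := hg (f σ) h1
  refine ⟨h4, by simp only [Function.comp, h5, h2, add_assoc], fun hne => ?_⟩
  have : f σ ≠ [] := by
    intro h
    rw [h, List.length_nil] at h2
    exact hne (List.length_eq_zero_iff.1 (by omega))
  simp only [Function.comp, h6 this, h3 hne]

lemma IsSimulation.prefix_of_prefix (hU : ∀ σ τ, σ <+: τ → U τ → U σ) (hf : IsSimulation s U V f)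
    {σ τ : List ℕ} (hτ : U τ) (h : σ <+: τ) : f σ <+: f τ := by
  obtain ⟨ρ, rfl⟩ := h
  induction ρ using List.reverseRecOn with
  | nil => simp
  | append_singleton ρ a ih =>
    rw [← List.append_assoc] at hτ ⊢
    have h := (hf _ hτ).2.2 (by simp)
    rw [List.dropLast_concat] at h
    exact (ih (hU _ _ (List.prefix_append _ _) hτ)).trans (h ▸ List.dropLast_prefix _)

lemma IsSimulation.exists_branch (hU : ∀ σ τ, σ <+: τ → U τ → U σ)
    (hV : ∀ σ τ, σ <+: τ → V τ → V σ) (hf : IsSimulation s U V f) {z : Baire}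
    (hz : ∀ k, U (pre z k)) : ∃ z' : Baire, ∀ k, V (pre z' k) := by
  refine exists_branch_of_chain hV (fun k => f (pre z k)) (fun k => (hf _ (hz k)).1)
    (fun k => hf.prefix_of_prefix hU (hz _) (pre_prefix z (Nat.le_succ k))) fun k => ?_
  rw [(hf _ (hz k)).2.1, length_pre]
  exact Nat.le_add_right _ _

lemma IsSimulation.exists_branch_of_self (hU : ∀ σ τ, σ <+: τ → U τ → U σ) (hnil : U [])
    (hf : IsSimulation 1 U U f) : ∃ z : Baire, ∀ k, U (pre z k) := by
  have hmem : ∀ k, U (f^[k] []) ∧ (f^[k] []).length = k := by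
    intro k
    induction k with
    | zero => exact ⟨hnil, rfl⟩
    | succ k ih =>
      rw [Function.iterate_succ_apply']
      exact ⟨(hf _ ih.1).1, by rw [(hf _ ih.1).2.1, ih.2]⟩
  refine exists_branch_of_chain hU (fun k => f^[k] []) (fun k => (hmem k).1) (fun k => ?_)
    fun k => (hmem k).2.ge
  induction k with
  | zero => simp
  | succ k ih =>
    have := hf.prefix_of_prefix hU (hmem (k + 1)).1 ih
    rwa [← Function.iterate_succ_apply' f, ← Function.iterate_succ_apply' f] at this

lemma isSimulation_of_branch {z : Baire} (hz : ∀ k, V (pre z k)) (s : ℕ) (U : List ℕ → Prop) :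
    IsSimulation s U V fun σ => pre z (σ.length + s) := by
  intro σ _
  refine ⟨hz _, length_pre _ _, fun hne => ?_⟩
  have h : 0 < σ.length := List.length_pos_iff.2 hne
  simp only [List.dropLast_eq_take, length_pre, take_pre _ (Nat.sub_le _ _), List.length_take]
  congr 1
  omega

lemma wellFounded_isChild (hU : ∀ σ τ, σ <+: τ → U τ → U σ)
    (h : ¬ ∃ z : Baire, ∀ k, U (pre z k)) : WellFounded (IsChild U) := by
  rw [wellFounded_iff_isEmpty_descending_chain]
  refine ⟨fun ⟨g, hg⟩ => h ?_⟩
  have hlen : ∀ k, k ≤ (g k).length := by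
    intro k
    induction k with
    | zero => exact Nat.zero_le _
    | succ k ih =>
      obtain ⟨-, a, ha⟩ := hg k
      rw [ha, List.length_append, List.length_singleton]
      omega
  have hpre : ∀ k, g k <+: g (k + 1) := fun k => by
    obtain ⟨-, a, ha⟩ := hg k
    exact ha ▸ List.prefix_append _ _
  exact exists_branch_of_chain hU g (fun k => hU _ _ (hpre k) (hg k).1) hpre hlen

lemma exists_isChild_of_lt_rank {σ : List ℕ} (h : Acc (IsChild V) σ) {o : Ordinal.{0}}
    (ho : o < h.rank) : ∃ a, ∃ ha : IsChild V (σ ++ [a]) σ, o ≤ (h.inv ha).rank := by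
  rw [h.rank_eq, Ordinal.lt_iSup_iff] at ho
  obtain ⟨⟨b, hb⟩, hlt⟩ := ho
  obtain ⟨-, a, rfl⟩ := id hb
  exact ⟨a, hb, Order.lt_succ_iff.1 hlt⟩

lemma exists_isSimulation (hU : ∀ σ τ, σ <+: τ → U τ → U σ)
    (wU : WellFounded (IsChild U)) (wV : WellFounded (IsChild V)) {ρ : List ℕ} (hρ : V ρ)
    (hrank : (wU.apply []).rank ≤ (wV.apply ρ).rank) :
    ∃ f, IsSimulation ρ.length U V f := by
  classical
  have step : ∀ σ τ a, ∃ b, U (σ ++ [a]) → (wU.apply σ).rank ≤ (wV.apply τ).rank →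
      V (τ ++ [b]) ∧ (wU.apply (σ ++ [a])).rank ≤ (wV.apply (τ ++ [b])).rank := by
    intro σ τ a
    by_cases hc : U (σ ++ [a]) ∧ (wU.apply σ).rank ≤ (wV.apply τ).rank
    · have hlt := (Acc.rank_lt_of_rel (wU.apply σ) ⟨hc.1, a, rfl⟩).trans_le hc.2
      obtain ⟨b, hb, hle⟩ := exists_isChild_of_lt_rank (wV.apply τ) hlt
      exact ⟨b, fun _ _ => ⟨hb.1, hle⟩⟩
    · exact ⟨0, fun h1 h2 => absurd ⟨h1, h2⟩ hc⟩
  choose next hnext using step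
  let F : List ℕ → List ℕ :=
    fun σ => List.rec ρ (fun a σ r => r ++ [next σ.reverse r a]) σ
  have hF : ∀ σ, U σ.reverse → V (F σ) ∧ (wU.apply σ.reverse).rank ≤ (wV.apply (F σ)).rank ∧
      (F σ).length = σ.length + ρ.length := by
    intro σ
    induction σ with
    | nil => exact fun _ => ⟨hρ, hrank, (Nat.zero_add _).symm⟩
    | cons a σ ih =>
      intro h
      rw [List.reverse_cons] at h
      obtain ⟨-, h2, h3⟩ := ih (hU _ _ (List.prefix_append _ _) h)
      have h4 := hnext σ.reverse (F σ) a h h2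
      refine ⟨h4.1, ?_, ?_⟩
      · simp only [List.reverse_cons]
        exact h4.2
      · change (F σ ++ [_]).length = _
        rw [List.length_append, h3, List.length_singleton, List.length_cons]
        omega
  refine ⟨fun σ => F σ.reverse, fun σ hσ => ?_⟩
  have h := hF σ.reverse (by rwa [List.reverse_reverse])
  refine ⟨h.1, by rw [h.2.2, List.length_reverse], fun hne => ?_⟩
  obtain ⟨τ, a, rfl⟩ := List.eq_nil_or_concat σ |>.resolve_left hne
  simp [F]

/-- The shift demanded of a simulation from the tree `T v` to the tree `T w`: ties between trees of
equal rank are broken in favour of the smaller index. -/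
def tieShift (v w : ℕ) : ℕ := if w < v then 1 else 0

/-- The indices of the trees of least rank in a sequence of trees, expressed through simulations. -/
def LeastTree (T : ℕ → List ℕ → Prop) (v : ℕ) : Prop :=
  ∀ w, ∃ f, IsSimulation (tieShift v w) (T v) (T w) f

variable {T : ℕ → List ℕ → Prop}

lemma LeastTree.not_branch (hT : ∀ v σ τ, σ <+: τ → T v τ → T v σ) {v w : ℕ} (hv : LeastTree T v)
    (hw : ¬ ∃ z : Baire, ∀ k, T w (pre z k)) : ¬ ∃ z : Baire, ∀ k, T v (pre z k) := by
  rintro ⟨z, hz⟩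
  obtain ⟨f, hf⟩ := hv w
  exact hw (hf.exists_branch (hT v) (hT w) hz)

lemma LeastTree.unique (hT : ∀ v σ τ, σ <+: τ → T v τ → T v σ) (hnil : ∀ v, T v []) {u v w : ℕ}
    (hu : LeastTree T u) (hv : LeastTree T v) (hw : ¬ ∃ z : Baire, ∀ k, T w (pre z k)) :
    u = v := by
  wlog h : u < v generalizing u v
  · by_contra hne
    exact hne (this hv hu (by omega)).symm
  obtain ⟨f, hf⟩ := hu v
  obtain ⟨g, hg⟩ := hv u
  rw [tieShift, if_neg h.not_gt] at hf
  rw [tieShift, if_pos h] at hg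
  exact absurd ((hg.comp hf).exists_branch_of_self (hT u) (hnil u)) (hu.not_branch hT hw)

lemma leastTree_of_forall_branch (h : ∀ w, ∃ z : Baire, ∀ k, T w (pre z k)) (v : ℕ) :
    LeastTree T v := fun w =>
  let ⟨_, hz⟩ := h w
  ⟨_, isSimulation_of_branch hz _ _⟩

lemma exists_leastTree (hT : ∀ v σ τ, σ <+: τ → T v τ → T v σ) (hnil : ∀ v, T v []) :
    ∃ v, LeastTree T v := by
  classical
  by_cases hall : ∀ w, ∃ z : Baire, ∀ k, T w (pre z k)
  · exact ⟨0, leastTree_of_forall_branch hall 0⟩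
  let rk : ℕ → Ordinal.{0} := fun w =>
    if h : WellFounded (IsChild (T w)) then (h.apply []).rank else 0
  have hrk : ∀ w (h : WellFounded (IsChild (T w))), rk w = (h.apply []).rank := fun w h => dif_pos h
  obtain ⟨v, hv, hmin⟩ := WellFounded.has_min
    (InvImage.wf (fun w => toLex (rk w, w)) wellFounded_lt)
    {w | ¬ ∃ z : Baire, ∀ k, T w (pre z k)} (not_forall.1 hall)
  refine ⟨v, fun w => ?_⟩
  by_cases hw : ∃ z : Baire, ∀ k, T w (pre z k)
  · obtain ⟨z, hz⟩ := hw
    exact ⟨_, isSimulation_of_branch hz _ _⟩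
  have wv := wellFounded_isChild (hT v) hv
  have ww := wellFounded_isChild (hT w) hw
  have hle := hmin w hw
  simp only [InvImage, Prod.Lex.toLex_lt_toLex, not_or, not_lt, not_and, hrk v wv, hrk w ww] at hle
  rw [tieShift]
  split_ifs with hwv
  · have hlt : (wv.apply []).rank < (ww.apply []).rank :=
      lt_of_le_of_ne hle.1 fun h => absurd (hle.2 h.symm) hwv.not_ge
    obtain ⟨a, ha, hr⟩ := exists_isChild_of_lt_rank (ww.apply []) hlt
    exact exists_isSimulation (hT v) wv ww ha.1 hr
  · exact exists_isSimulation (hT v) wv ww (hnil w) hle.1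

end Simulation

section Definability

open Encodable Denumerable

lemma Primrec.list_dropLast {α : Type*} [Primcodable α] :
    Primrec (List.dropLast : List α → List α) :=
  (Primrec.list_take.comp (Primrec.nat_sub.comp Primrec.list_length (Primrec.const 1))
    Primrec.id).of_eq fun _ => List.dropLast_eq_take.symm

/-- Being the index of a tree of least rank in a uniformly computable sequence of trees
is `Σ¹₁`. -/
lemma isSigma11_leastTree {U : ℕ × ℕ → List ℕ → Bool} (hU : Computable₂ U) :
    IsSigma11 fun p : ℕ × ℕ => LeastTree (fun w σ => U (p.1, w) σ = true) p.2 := by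
  classical
  let Node := ℕ × List ℕ
  let levelOk : ℕ × ((Node × List ℕ) × (Node × List ℕ)) → Prop := fun d =>
    d.2.1.2.length = d.2.1.1.2.length + if d.2.1.1.1 < d.1 then 1 else 0
  let parentOk : ((Node × List ℕ) × (Node × List ℕ)) → Prop := fun d =>
    ¬ (d.2.1.1 = d.1.1.1 ∧ ¬ d.1.1.2 = [] ∧ d.2.1.2 = d.1.1.2.dropLast) ∨ d.1.2.dropLast = d.2.2
  have node₁ : Primrec fun d : (Node × List ℕ) × (Node × List ℕ) => d.1.1.2 :=
    Primrec.snd.comp (Primrec.fst.comp Primrec.fst)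
  have level : PrimrecPred levelOk := by
    have hidx : Primrec fun d : ℕ × ((Node × List ℕ) × (Node × List ℕ)) => d.2.1.1.1 :=
      Primrec.fst.comp (Primrec.fst.comp (Primrec.fst.comp Primrec.snd))
    have hval : Primrec fun d : ℕ × ((Node × List ℕ) × (Node × List ℕ)) => d.2.1.2 :=
      Primrec.snd.comp (Primrec.fst.comp Primrec.snd)
    exact Primrec.eq.comp (Primrec.list_length.comp hval)
      (Primrec.nat_add.comp (Primrec.list_length.comp (node₁.comp Primrec.snd))
        (Primrec.ite (Primrec.nat_lt.comp hidx Primrec.fst) (Primrec.const 1) (Primrec.const 0)))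
  have parent : PrimrecPred parentOk := by
    have hidx₁ : Primrec fun d : (Node × List ℕ) × (Node × List ℕ) => d.1.1.1 :=
      Primrec.fst.comp (Primrec.fst.comp Primrec.fst)
    have hidx₂ : Primrec fun d : (Node × List ℕ) × (Node × List ℕ) => d.2.1.1 :=
      Primrec.fst.comp (Primrec.fst.comp Primrec.snd)
    have node₂ : Primrec fun d : (Node × List ℕ) × (Node × List ℕ) => d.2.1.2 :=
      Primrec.snd.comp (Primrec.fst.comp Primrec.snd)
    exact (((Primrec.eq.comp hidx₂ hidx₁).and ((Primrec.eq.comp node₁ (Primrec.const [])).not.and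
      (Primrec.eq.comp node₂ (Primrec.list_dropLast.comp node₁)))).not).or
      (Primrec.eq.comp (Primrec.list_dropLast.comp (Primrec.snd.comp Primrec.fst))
        (Primrec.snd.comp Primrec.snd))
  let dec : (ℕ × ℕ) × (ℕ × ℕ) → (Node × List ℕ) × (Node × List ℕ) := fun d =>
    ((ofNat Node d.1.1, ofNat (List ℕ) d.1.2), (ofNat Node d.2.1, ofNat (List ℕ) d.2.2))
  have hdec : Primrec dec :=
    (((Primrec.ofNat Node).comp (Primrec.fst.comp Primrec.fst)).pair
      ((Primrec.ofNat (List ℕ)).comp (Primrec.snd.comp Primrec.fst))).pair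
    (((Primrec.ofNat Node).comp (Primrec.fst.comp Primrec.snd)).pair
      ((Primrec.ofNat (List ℕ)).comp (Primrec.snd.comp Primrec.snd)))
  let q : ℕ × ℕ → (ℕ × ℕ) × (ℕ × ℕ) → Bool := fun p d =>
    !(U p (dec d).1.1.2) || (U (p.1, (dec d).1.1.1) (dec d).1.2 &&
      (decide (levelOk (p.2, dec d)) && decide (parentOk (dec d))))
  have hq : Computable₂ q := by
    have hd : Computable fun x : (ℕ × ℕ) × ((ℕ × ℕ) × (ℕ × ℕ)) => dec x.2 :=
      hdec.to_comp.comp Computable.snd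
    have h1 : Computable fun x : (ℕ × ℕ) × ((ℕ × ℕ) × (ℕ × ℕ)) => U x.1 (dec x.2).1.1.2 :=
      hU.comp Computable.fst (node₁.to_comp.comp hd)
    have h2 : Computable fun x : (ℕ × ℕ) × ((ℕ × ℕ) × (ℕ × ℕ)) =>
        U (x.1.1, (dec x.2).1.1.1) (dec x.2).1.2 :=
      hU.comp ((Computable.fst.comp Computable.fst).pair
        (Computable.fst.comp (Computable.fst.comp (Computable.fst.comp hd))))
        (Computable.snd.comp (Computable.fst.comp hd))
    have h3 : Computable fun x : (ℕ × ℕ) × ((ℕ × ℕ) × (ℕ × ℕ)) =>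
        decide (levelOk (x.1.2, dec x.2)) :=
      level.decide.to_comp.comp ((Computable.snd.comp Computable.fst).pair hd)
    have h4 : Computable fun x : (ℕ × ℕ) × ((ℕ × ℕ) × (ℕ × ℕ)) => decide (parentOk (dec x.2)) :=
      parent.decide.to_comp.comp hd
    exact Primrec.or.to_comp.comp (Primrec.not.to_comp.comp h1)
      (Primrec.and.to_comp.comp h2 (Primrec.and.to_comp.comp h3 h4))
  obtain ⟨R, hR, hRq⟩ := IsSigma11.exists_forall_pair hq
  refine ⟨R, hR, fun p => Iff.trans ?_ (hRq p)⟩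
  have key : ∀ i j a b, q p ((i, a), (j, b)) = true ↔
      (U p (ofNat Node i).2 = true → U (p.1, (ofNat Node i).1) (ofNat (List ℕ) a) = true ∧
        levelOk (p.2, dec ((i, a), (j, b))) ∧ parentOk (dec ((i, a), (j, b)))) := by
    intro i j a b
    simp only [q, Bool.or_eq_true, Bool.and_eq_true, decide_eq_true_eq, Bool.not_eq_true', dec]
    cases U p (ofNat Node i).2 <;> simp
  simp only [key, levelOk, parentOk, dec]
  constructor
  · intro h
    choose f hf using h
    refine ⟨fun i => encode (f (ofNat Node i).1 (ofNat Node i).2), fun i j hi => ?_⟩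
    simp only [ofNat_encode]
    obtain ⟨h1, h2, h3⟩ := hf (ofNat Node i).1 (ofNat Node i).2 hi
    refine ⟨h1, h2, ?_⟩
    by_cases hj : (ofNat Node j).1 = (ofNat Node i).1 ∧ ¬ (ofNat Node i).2 = [] ∧
        (ofNat Node j).2 = (ofNat Node i).2.dropLast
    · right
      rw [h3 hj.2.1, hj.1, hj.2.2]
    · exact Or.inl hj
  · rintro ⟨y, hy⟩ w
    refine ⟨fun σ => ofNat (List ℕ) (y (encode ((w, σ) : Node))), fun σ hσ => ?_⟩
    have h := hy (encode ((w, σ) : Node)) (encode ((w, σ.dropLast) : Node))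
    simp only [ofNat_encode] at h
    obtain ⟨h1, h2, h3⟩ := h hσ
    exact ⟨h1, h2, fun hne => h3.resolve_left fun h => h ⟨trivial, hne, trivial⟩⟩

end Definability

section Diagonal

open Encodable Denumerable Nat.Partrec

lemma TuringFunctional.exists_code (Φ : TuringFunctional) :
    ∃ c : Code, ∀ σ, encode (Φ.φ σ) ∈ c.eval (encode σ) := by
  obtain ⟨c, hc⟩ := Code.exists_code.1 Φ.computable
  exact ⟨c, fun σ => by rw [hc]; simp⟩

/-- The value at coordinate `2 * e + 1` output by the `e`-th functional within `s` steps on the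
first `m` entries of `l`, where `l` has length `Nat.pair m s`. -/
def diagValue (e : ℕ) (l : List ℕ) : Option ℕ :=
  (Code.evaln l.length.unpair.2 (ofNat Code e) (encode (l.take l.length.unpair.1))).bind
    fun o => (ofNat (List ℕ) o)[2 * e + 1]?

lemma primrec_diagValue : Primrec₂ diagValue := by
  have hlen : Primrec fun p : ℕ × List ℕ => p.2.length.unpair :=
    Primrec.unpair.comp (Primrec.list_length.comp Primrec.snd)
  have h1 : Primrec fun p : ℕ × List ℕ => Code.evaln p.2.length.unpair.2 (ofNat Code p.1)
      (encode (p.2.take p.2.length.unpair.1)) :=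
    Code.primrec_evaln.comp (((Primrec.snd.comp hlen).pair
      ((Primrec.ofNat Code).comp Primrec.fst)).pair
      (Primrec.encode.comp (Primrec.list_take.comp (Primrec.fst.comp hlen) Primrec.snd)))
  refine Primrec.option_bind h1 ?_
  exact Primrec.list_getElem?.comp ((Primrec.ofNat (List ℕ)).comp Primrec.snd)
    (Primrec.nat_double_succ.comp (Primrec.fst.comp Primrec.fst))

variable {Φ : TuringFunctional} {c : Code} {x y : Baire}

lemma exists_of_diagValue (hc : ∀ σ, encode (Φ.φ σ) ∈ c.eval (encode σ)) {k u : ℕ}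
    (h : diagValue (encode c) (pre x k) = some u) :
    ∃ m, (Φ.φ (pre x m))[2 * encode c + 1]? = some u := by
  rw [diagValue, Option.bind_eq_some_iff] at h
  obtain ⟨o, ho, hu⟩ := h
  rw [ofNat_encode, length_pre, take_pre x (Nat.unpair_left_le k)] at ho
  have : o = encode (Φ.φ (pre x k.unpair.1)) := Part.mem_unique (Code.evaln_sound ho) (hc _)
  rw [this, ofNat_encode] at hu
  exact ⟨_, hu⟩

lemma exists_diagValue_eq (hc : ∀ σ, encode (Φ.φ σ) ∈ c.eval (encode σ)) {m u : ℕ}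
    (h : (Φ.φ (pre x m))[2 * encode c + 1]? = some u) :
    ∃ k, diagValue (encode c) (pre x k) = some u := by
  obtain ⟨s, hs⟩ := Code.evaln_complete.1 (hc (pre x m))
  refine ⟨Nat.pair m s, ?_⟩
  rw [diagValue, length_pre, Nat.unpair_pair, take_pre x (Nat.left_le_pair m s), ofNat_encode,
    Option.mem_def.1 hs, Option.bind_some, ofNat_encode, h]

lemma TuringFunctional.Eval.eq_of_getElem? (h : Φ.Eval x y) {n m u : ℕ}
    (hu : (Φ.φ (pre x m))[n]? = some u) : u = y n := by
  obtain ⟨m', hm'⟩ := h n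
  have aux : ∀ {a b v : ℕ}, a ≤ b → (Φ.φ (pre x a))[n]? = some v →
      (Φ.φ (pre x b))[n]? = some v := by
    intro a b v hab hv
    obtain ⟨ρ, hρ⟩ := Φ.mono _ _ (pre_prefix x hab)
    rw [← hρ, List.getElem?_append_left (List.getElem?_eq_some_iff.1 hv).1, hv]
  have h1 := aux (le_max_left m m') hu
  have h2 := aux (le_max_right m m') hm'
  exact Option.some_injective _ (h1.symm.trans h2)

lemma isOpen_setOf_pre (p : List ℕ → Prop) (m : ℕ) : IsOpen {x : Baire | p (pre x m)} := by
  have hcont : Continuous fun (x : Baire) (i : Fin m) => x i :=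
    continuous_pi fun i => continuous_apply (i : ℕ)
  have heq : {x : Baire | p (pre x m)} =
      (fun (x : Baire) (i : Fin m) => x i) ⁻¹' {g | p (List.ofFn g)} := by
    ext x
    have : pre x m = List.ofFn fun i : Fin m => x i := by
      apply List.ext_getElem <;> simp [pre]
    simp only [Set.mem_ofPred_eq, Set.mem_preimage, this]
  rw [heq]
  exact (isOpen_discrete _).preimage hcont

/-- A functional that is total on a product of finite sets omits a value at each coordinate. -/
lemma exists_omitted_value {A : ℕ → Set ℕ} (hA : ∀ n, (A n).Finite) (n : ℕ)
    (hΦ : ∀ x ∈ homProd A, ∃ m u, (Φ.φ (pre x m))[n]? = some u) :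
    ∃ v, ∀ x ∈ homProd A, ∃ m u, (Φ.φ (pre x m))[n]? = some u ∧ u ≠ v := by
  have hcomp : IsCompact (homProd A) := by
    have : homProd A = Set.univ.pi A := by
      ext x
      simp [homProd]
    rw [this]
    exact isCompact_univ_pi fun n => (hA n).isCompact
  let O : ℕ → Set Baire := fun u => {x | ∃ m, (Φ.φ (pre x m))[n]? = some u}
  have hO : ∀ u, IsOpen (O u) := fun u => by
    have : O u = ⋃ m, {x | (Φ.φ (pre x m))[n]? = some u} := by
      ext x
      simp [O]
    rw [this]
    exact isOpen_iUnion fun m => isOpen_setOf_pre (fun l => (Φ.φ l)[n]? = some u) m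
  obtain ⟨F, hF⟩ := hcomp.elim_finite_subcover O hO fun x hx => by
    obtain ⟨m, u, hu⟩ := hΦ x hx
    exact Set.mem_iUnion.2 ⟨u, m, hu⟩
  obtain ⟨v, hv⟩ := Infinite.exists_notMem_finset F
  refine ⟨v, fun x hx => ?_⟩
  obtain ⟨u, huF, m, hu⟩ := Set.mem_iUnion₂.1 (hF hx)
  exact ⟨m, u, hu, fun h => hv (h ▸ huF)⟩

end Diagonal

section Construction

/-- `x` lies in the product of the `A n`, and the `e`-th functional does not output on `x` a value
different from `v` at coordinate `2 * e + 1`. -/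
def Survives (A : ℕ → Set ℕ) (e v : ℕ) (x : Baire) : Prop :=
  x ∈ homProd A ∧ ∀ k u, diagValue e (pre x k) = some u → u = v

lemma isSigma11_exists_survives {A : ℕ → Set ℕ} (hA : UniformlySigma11 A) :
    IsSigma11 fun p : ℕ × ℕ => ∃ x, Survives A p.1 p.2 x := by
  obtain ⟨R, hR, hAR⟩ := hA
  let last : List ℕ → ℕ × ℕ := fun l => (l.length - 1, l.getD (l.length - 1) 0)
  have hlast : Primrec last := by
    have h : Primrec fun l : List ℕ => l.length - 1 :=
      Primrec.nat_sub.comp Primrec.list_length (Primrec.const 1)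
    exact h.pair ((Primrec.list_getD 0).comp Primrec.id h)
  let good : (ℕ × ℕ) × List ℕ → Prop := fun d =>
    diagValue d.1.1 d.2 = none ∨ diagValue d.1.1 d.2 = some d.1.2
  have hgood : PrimrecPred good := by
    have h : Primrec fun d : (ℕ × ℕ) × List ℕ => diagValue d.1.1 d.2 :=
      primrec_diagValue.comp (Primrec.fst.comp Primrec.fst) Primrec.snd
    exact (Primrec.eq.comp h (Primrec.const none)).or
      (Primrec.eq.comp h (Primrec.option_some.comp (Primrec.snd.comp Primrec.fst)))
  classical
  have hgoodc : Computable fun d => decide (good d) := hgood.decide.to_comp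
  have hnil : Computable fun d : (ℕ × ℕ) × List ℕ => decide (d.2 = []) :=
    ((Primrec.eq.comp (Primrec.snd : Primrec (Prod.snd : (ℕ × ℕ) × List ℕ → _))
      (Primrec.const [])).decide).to_comp
  have hQ : IsSigma11 fun d : (ℕ × ℕ) × List ℕ =>
      ∃ y : Baire, ∀ k, ((decide (d.2 = []) || R (last d.2) (pre y k)) && decide (good d)) = true :=
    ⟨_, (Primrec.and.to_comp.comp
      (Primrec.or.to_comp.comp (hnil.comp Computable.fst)
        (hR.comp (hlast.to_comp.comp (Computable.snd.comp Computable.fst)) Computable.snd))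
      (hgoodc.comp Computable.fst)).to₂, fun _ => Iff.rfl⟩
  obtain ⟨S, hS, hSQ⟩ := hQ.exists_forall
  refine ⟨S, hS, fun p => Iff.trans (exists_congr fun x => ?_) (hSQ p)⟩
  have hlast_succ : ∀ n, last (pre x (n + 1)) = (n, x n) := fun n => by
    simp only [last, length_pre, Nat.add_sub_cancel]
    rw [getD_pre x (Nat.lt_succ_self n)]
  have hgood_iff : ∀ k, good (p, pre x k) ↔
      ∀ u, diagValue p.1 (pre x k) = some u → u = p.2 := fun k => by
    simp only [good]
    cases diagValue p.1 (pre x k) <;> simp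
  simp only [Bool.and_eq_true, Bool.or_eq_true, decide_eq_true_eq, hgood_iff]
  constructor
  · rintro ⟨hx, h⟩ k
    rcases k with _ | n
    · exact ⟨fun _ => 0, fun _ => ⟨Or.inl rfl, h _⟩⟩
    · obtain ⟨y, hy⟩ := (hAR n (x n)).1 (hx n)
      exact ⟨y, fun j => ⟨Or.inr (hlast_succ n ▸ hy j), h _⟩⟩
  · intro h
    refine ⟨fun n => ?_, fun k => ?_⟩
    · obtain ⟨y, hy⟩ := h (n + 1)
      refine (hAR n (x n)).2 ⟨y, fun j => ?_⟩
      rw [← hlast_succ n]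
      exact (hy j).1.resolve_left (by simp [← List.length_eq_zero_iff])
    · obtain ⟨y, hy⟩ := h k
      exact (hy 0).2

/-- A uniformly `Σ¹₁` family of sets, each of which is `ℕ` or a singleton, which selects for each
`e` a value `v` such that nothing `Survives`, if there is one. -/
lemma exists_sigma11_selector {P : ℕ × ℕ → Prop} (hP : IsSigma11 P) :
    ∃ C : ℕ → Set ℕ, UniformlySigma11 C ∧ (∀ e, C e = Set.univ ∨ ∃ v, C e = {v}) ∧
      ∀ e, (∃ v, ¬ P (e, v)) → ∀ v ∈ C e, ¬ P (e, v) := by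
  obtain ⟨U, hU, hnil, hclosed, hPU⟩ := hP.exists_tree
  obtain ⟨R, hR, hRC⟩ := isSigma11_leastTree hU
  let T : ℕ → ℕ → List ℕ → Prop := fun e w σ => U (e, w) σ = true
  have hT : ∀ e v σ τ, σ <+: τ → T e v τ → T e v σ := fun e v => hclosed (e, v)
  refine ⟨fun e => {v | LeastTree (T e) v}, ⟨R, hR, fun e v => hRC (e, v)⟩, fun e => ?_,
    fun e => ?_⟩
  · by_cases h : ∀ w, ∃ z : Baire, ∀ k, T e w (pre z k)
    · exact Or.inl (Set.eq_univ_of_forall fun v => leastTree_of_forall_branch h v)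
    · obtain ⟨w, hw⟩ := not_forall.1 h
      obtain ⟨v, hv⟩ := exists_leastTree (hT e) fun v => hnil (e, v)
      exact Or.inr ⟨v, Set.eq_singleton_iff_unique_mem.2
        ⟨hv, fun u hu => LeastTree.unique (hT e) (fun v => hnil (e, v)) hu hv hw⟩⟩
  · rintro ⟨w, hw⟩ v hv
    rw [hPU] at hw ⊢
    exact LeastTree.not_branch (hT e) hv hw

/-- The family with the sets `A n` at even and the sets `C n` at odd coordinates. -/
def interleave (A C : ℕ → Set ℕ) (n : ℕ) : Set ℕ := bif n.bodd then C n.div2 else A n.div2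

lemma interleave_even (A C : ℕ → Set ℕ) (n : ℕ) : interleave A C (2 * n) = A n := by
  simp [interleave, Nat.div2_val]

lemma interleave_odd (A C : ℕ → Set ℕ) (n : ℕ) : interleave A C (2 * n + 1) = C n := by
  simp only [interleave, Nat.div2_val, Nat.bodd_succ, Nat.bodd_mul]
  rw [show (2 * n + 1) / 2 = n by omega]
  simp

lemma UniformlySigma11.interleave {A C : ℕ → Set ℕ} (hA : UniformlySigma11 A)
    (hC : UniformlySigma11 C) : UniformlySigma11 (interleave A C) := by
  obtain ⟨R, hR, hAR⟩ := hA
  obtain ⟨S, hS, hCS⟩ := hC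
  have harg : Computable fun d : (ℕ × ℕ) × List ℕ => (d.1.1.div2, d.1.2) :=
    (Computable.nat_div2.comp (Computable.fst.comp Computable.fst)).pair
      (Computable.snd.comp Computable.fst)
  refine ⟨fun p l => bif p.1.bodd then S (p.1.div2, p.2) l else R (p.1.div2, p.2) l,
    Computable.cond (Computable.nat_bodd.comp (Computable.fst.comp Computable.fst))
      (hS.comp harg Computable.snd) (hR.comp harg Computable.snd), fun n m => ?_⟩
  simp only [_root_.interleave]
  cases n.bodd
  · exact hAR _ _
  · exact hCS _ _

/-- The functional extracting the even coordinates. -/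
def evenFunctional : TuringFunctional where
  φ l := (List.range (l.length / 2)).map fun i => l.getD (2 * i) 0
  computable := by
    refine (Primrec.list_map (Primrec.list_range.comp (Primrec.nat_div.comp Primrec.list_length
      (Primrec.const 2))) ?_).to_comp
    exact (Primrec.list_getD 0).comp Primrec.fst (Primrec.nat_double.comp Primrec.snd)
  mono := by
    rintro σ _ ⟨ρ, rfl⟩
    rw [List.prefix_iff_getElem?]
    intro i hi
    simp only [List.length_map, List.length_range] at hi
    have h1 : i < (σ ++ ρ).length / 2 := by
      rw [List.length_append]
      omega
    have h2 : 2 * i < σ.length := by omega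
    have h3 : (σ ++ ρ)[2 * i]? = σ[2 * i]? := List.getElem?_append_left h2
    rw [List.getElem?_map, List.getElem?_range h1]
    simp only [Option.map_some, List.getElem_map, List.getElem_range, List.getD_eq_getElem?_getD, h3]

lemma eval_evenFunctional (x : Baire) : evenFunctional.Eval x fun n => x (2 * n) := by
  intro n
  refine ⟨2 * n + 2, ?_⟩
  have h : n < (pre x (2 * n + 2)).length / 2 := by
    rw [length_pre]
    omega
  simp only [evenFunctional]
  rw [List.getElem?_map, List.getElem?_range h, Option.map_some, getD_pre x (by omega)]

lemma medvedevLE_interleave (A C : ℕ → Set ℕ) :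
    MedvedevLE (homProd A) (homProd (interleave A C)) :=
  ⟨evenFunctional, fun x hx => ⟨_, fun n => interleave_even A C n ▸ hx (2 * n),
    eval_evenFunctional x⟩⟩

end Construction

/-- Above any nonempty homogeneous `Σ¹₁` set with finite factors there is a
strictly larger all-or-(nonempty-finite) homogeneous `Σ¹₁` set. -/
theorem exists_aof_strictly_above_fin :
    ∀ A : ℕ → Set ℕ, UniformlySigma11 A → (∀ n, (A n).Finite) →
      (homProd A).Nonempty →
      ∃ B : ℕ → Set ℕ, UniformlySigma11 B ∧
        (∀ n, B n = Set.univ ∨ ((B n).Nonempty ∧ (B n).Finite)) ∧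
        MedvedevLT (homProd A) (homProd B) := by
  intro A hA hfin hne
  obtain ⟨C, hC, hCsize, hCdiag⟩ := exists_sigma11_selector (isSigma11_exists_survives hA)
  refine ⟨interleave A C, hA.interleave hC, fun n => ?_, medvedevLE_interleave A C, ?_⟩
  · obtain ⟨x, hx⟩ := hne
    rcases Nat.even_or_odd' n with ⟨k, rfl | rfl⟩
    · rw [interleave_even]
      exact Or.inr ⟨⟨x k, hx k⟩, hfin k⟩
    · rw [interleave_odd]
      refine (hCsize k).imp_right ?_
      rintro ⟨v, hv⟩
      rw [hv]
      exact ⟨Set.singleton_nonempty v, Set.finite_singleton v⟩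
  · rintro ⟨Φ, hΦ⟩
    obtain ⟨c, hc⟩ := Φ.exists_code
    obtain ⟨v, hv⟩ := exists_omitted_value (Φ := Φ) hfin (2 * Encodable.encode c + 1) fun x hx => by
      obtain ⟨y, -, hy⟩ := hΦ x hx
      obtain ⟨m, hm⟩ := hy (2 * Encodable.encode c + 1)
      exact ⟨m, _, hm⟩
    have hv' : ¬ ∃ x, Survives A (Encodable.encode c) v x := by
      rintro ⟨x, hx, hx'⟩
      obtain ⟨m, u, hu, hne⟩ := hv x hx
      obtain ⟨k, hk⟩ := exists_diagValue_eq hc hu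
      exact hne (hx' k u hk)
    obtain ⟨x, hx⟩ := hne
    obtain ⟨y, hyB, hy⟩ := hΦ x hx
    have hyC := interleave_odd A C (Encodable.encode c) ▸ hyB (2 * Encodable.encode c + 1)
    refine hCdiag _ ⟨v, hv'⟩ _ hyC ⟨x, hx, fun k u hk => ?_⟩
    obtain ⟨m, hm⟩ := exists_of_diagValue hc hk
    exact hy.eq_of_getElem? hm
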